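/- arXiv:2303.04272 — 2 statements merged into one kernel-verified Lean document; each statement's English description precedes it below -/
import Mathlib

section
/- Under the hypotheses of the previous statement (exact orthogonality relations H_k^H H_k = R_k, H_k^H H_m = 0 for m ≠ k, H_k^H h_{d,u} = 0, h_{d,u}^H h_{d,n} = 0 for n ≠ u), and assuming additionally that h_k^H Φ_k R_k Φ_k^H h_k ≠ 0 for every k and h_{d,u}^H h_{d,u} ≠ 0 for every u, one has for each k ∈ {1,…,K}: H_k^H Q_1^H (Q_1 Q_1^H)^{-1} e_k = R_k Φ_k^H h_k / (h_k^H Φ_k R_k Φ_k^H h_k), where e_k is the k-th standard unit-basis vector of ℂ^{K+U_d}. -/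
open Matrix

/-- Identity (13) in the proof of Proposition 1: under the exact orthogonality relations,
`Hₖᴴ Q₁ᴴ (Q₁ Q₁ᴴ)⁻¹ eₖ = Rₖ Φₖᴴ hₖ / (hₖᴴ Φₖ Rₖ Φₖᴴ hₖ)`. -/
theorem stmt_4 (M N K Ud : ℕ)
    (H : Fin K → Matrix (Fin M) (Fin N) ℂ)
    (h : Fin K → Fin N → ℂ)
    (φ : Fin K → Fin N → ℝ)
    (Φ : Fin K → Matrix (Fin N) (Fin N) ℂ)
    (hΦ : ∀ k, Φ k = Matrix.diagonal fun i => Complex.exp (Complex.I * (φ k i : ℂ)))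
    (hd : Fin Ud → Fin M → ℂ)
    (R : Fin K → Matrix (Fin N) (Fin N) ℂ)
    (hR : ∀ k, (H k)ᴴ * H k = R k)
    (horth : ∀ k m, k ≠ m → (H k)ᴴ * H m = 0)
    (hHd : ∀ k u, (H k)ᴴ.mulVec (hd u) = 0)
    (hdorth : ∀ u n, u ≠ n → star (hd u) ⬝ᵥ hd n = 0)
    (g : Fin K → Fin M → ℂ)
    (hg : ∀ k, g k = (H k).mulVec ((Φ k)ᴴ.mulVec (h k)))
    (Q1 : Matrix (Fin K ⊕ Fin Ud) (Fin M) ℂ)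
    (hQ1 : Q1 = Matrix.of (Sum.elim (fun k => star (g k)) (fun u => star (hd u))))
    (hden : ∀ k, star (h k) ⬝ᵥ (Φ k * R k * (Φ k)ᴴ).mulVec (h k) ≠ 0)
    (hdu : ∀ u, star (hd u) ⬝ᵥ hd u ≠ 0) :
    ∀ k, ((H k)ᴴ * Q1ᴴ * (Q1 * Q1ᴴ)⁻¹).mulVec (Pi.single (Sum.inl k) 1) =
      (star (h k) ⬝ᵥ (Φ k * R k * (Φ k)ᴴ).mulVec (h k))⁻¹ •
        (R k * (Φ k)ᴴ).mulVec (h k) := by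
  classical
  have hgg : ∀ k m, star (g k) ⬝ᵥ g m =
      star ((Φ k)ᴴ.mulVec (h k)) ⬝ᵥ (((H k)ᴴ * H m).mulVec ((Φ m)ᴴ.mulVec (h m))) := by
    intro k m
    rw [hg k, hg m, star_mulVec (H k), ← dotProduct_mulVec, mulVec_mulVec]
  have hgk : ∀ k, star (g k) ⬝ᵥ g k = star (h k) ⬝ᵥ (Φ k * R k * (Φ k)ᴴ).mulVec (h k) := by
    intro k
    rw [hgg, hR, star_mulVec, conjTranspose_conjTranspose, ← dotProduct_mulVec, mulVec_mulVec,
      mulVec_mulVec, Matrix.mul_assoc]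
  have hgd : ∀ k u, star (g k) ⬝ᵥ hd u = 0 := by
    intro k u
    rw [hg k, star_mulVec (H k), ← dotProduct_mulVec, hHd, dotProduct_zero]
  have hdg : ∀ k u, star (hd u) ⬝ᵥ g k = 0 := by
    intro k u
    rw [star_dotProduct, hgd, star_zero]
  have hQQ : Q1 * Q1ᴴ = Matrix.diagonal (Sum.elim (fun k => star (g k) ⬝ᵥ g k)
      (fun u => star (hd u) ⬝ᵥ hd u)) := by
    have key : ∀ i j, (Q1 * Q1ᴴ) i j = Q1 i ⬝ᵥ star (Q1 j) := fun i j => rfl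
    ext i j
    have hl : ∀ i, Q1 (Sum.inl i) = star (g i) := fun i => by rw [hQ1]; rfl
    have hr : ∀ i, Q1 (Sum.inr i) = star (hd i) := fun i => by rw [hQ1]; rfl
    rw [key]
    rcases i with i | i <;> rcases j with j | j
    · by_cases hij : i = j
      · subst hij; simp [hl, hr]
      · have : star (g i) ⬝ᵥ g j = 0 := by rw [hgg, horth i j hij]; simp
        simp [hl, hr, hij, this]
    · simp [hl, hr, hgd]
    · simp [hl, hr, hdg]
    · by_cases hij : i = j
      · subst hij; simp [hl, hr]
      · simp [hl, hr, hij, hdorth i j hij]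
  intro k
  have hinv : (Q1 * Q1ᴴ)⁻¹.mulVec (Pi.single (Sum.inl k) 1) =
      (star (g k) ⬝ᵥ g k)⁻¹ • Pi.single (Sum.inl k) 1 := by
    have hu : IsUnit (Q1 * Q1ᴴ).det := by
      rw [hQQ, det_diagonal, isUnit_iff_ne_zero, Finset.prod_ne_zero_iff]
      rintro (i | i) -
      · simpa [hgk] using hden i
      · simpa using hdu i
    have h2 : (Q1 * Q1ᴴ).mulVec ((star (g k) ⬝ᵥ g k)⁻¹ • Pi.single (Sum.inl k) 1) =
        Pi.single (Sum.inl k) 1 := by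
      have hne : star (g k) ⬝ᵥ g k ≠ 0 := by rw [hgk]; exact hden k
      rw [hQQ, mulVec_smul, diagonal_mulVec_single, ← Pi.single_smul]
      simp [hne]
    conv_lhs => rw [← h2]
    rw [mulVec_mulVec, nonsing_inv_mul _ hu, one_mulVec]
  have hcol : Q1ᴴ.mulVec (Pi.single (Sum.inl k) 1) = g k := by
    ext i
    simp [hQ1, conjTranspose_apply]
  rw [← mulVec_mulVec, hinv, mulVec_smul, ← mulVec_mulVec, hcol, hgk, hg, mulVec_mulVec, hR,
    mulVec_mulVec]
end

section
/- Under the exact orthogonality relations of Proposition 1's proof (H_k^H H_k = R_k with entries R_{k,i,ℓ}, H_k^H H_m = 0 for m ≠ k, H_k^H h_{d,u} = 0, h_{d,u}^H h_{d,n} = 0 for n ≠ u, h_k^H Φ_k R_k Φ_k^H h_k real and positive, h_{d,u}^H h_{d,u} ≠ 0), the per-element optimality condition φ_{k,i} = -arg( h_{k,i}^* [H_k^H Q_1^H (Q_1 Q_1^H)^{-1} e_k]_i ) is equivalent to the fixed-point system φ_{k,i} = -arg( h_{k,i}^* ∑_{ℓ=1}^{N} R_{k,i,ℓ} e^{-j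 φ_{k,ℓ}} h_{k,ℓ} ) for all i ∈ {1,…,N} (equality of arguments modulo 2π). -/
open Matrix

/-- Proposition 1 (deterministic form): under the exact orthogonality relations, the
per-element optimality condition `φ_{k,i} = -arg(h_{k,i}^* [Hₖᴴ Q₁ᴴ (Q₁Q₁ᴴ)⁻¹ eₖ]_i)` is
equivalent (modulo 2π) to the fixed-point system
`φ_{k,i} = -arg(h_{k,i}^* ∑ ℓ, R_{k,i,ℓ} e^{-jφ_{k,ℓ}} h_{k,ℓ})`. -/
theorem stmt_6 (M N K Ud : ℕ)
    (H : Fin K → Matrix (Fin M) (Fin N) ℂ)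
    (h : Fin K → Fin N → ℂ)
    (φ : Fin K → Fin N → ℝ)
    (Φ : Fin K → Matrix (Fin N) (Fin N) ℂ)
    (hΦ : ∀ k, Φ k = Matrix.diagonal fun i => Complex.exp (Complex.I * (φ k i : ℂ)))
    (hd : Fin Ud → Fin M → ℂ)
    (R : Fin K → Matrix (Fin N) (Fin N) ℂ)
    (hR : ∀ k, (H k)ᴴ * H k = R k)
    (horth : ∀ k m, k ≠ m → (H k)ᴴ * H m = 0)
    (hHd : ∀ k u, (H k)ᴴ.mulVec (hd u) = 0)
    (hdorth : ∀ u n, u ≠ n → star (hd u) ⬝ᵥ hd n = 0)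
    (g : Fin K → Fin M → ℂ)
    (hg : ∀ k, g k = (H k).mulVec ((Φ k)ᴴ.mulVec (h k)))
    (Q1 : Matrix (Fin K ⊕ Fin Ud) (Fin M) ℂ)
    (hQ1 : Q1 = Matrix.of (Sum.elim (fun k => star (g k)) (fun u => star (hd u))))
    (hposim : ∀ k, (star (h k) ⬝ᵥ (Φ k * R k * (Φ k)ᴴ).mulVec (h k)).im = 0)
    (hposre : ∀ k, 0 < (star (h k) ⬝ᵥ (Φ k * R k * (Φ k)ᴴ).mulVec (h k)).re)
    (hdu : ∀ u, star (hd u) ⬝ᵥ hd u ≠ 0) :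
    ∀ (k : Fin K) (i : Fin N),
      (∃ n : ℤ, φ k i =
          -(star (h k i) *
              (((H k)ᴴ * Q1ᴴ * (Q1 * Q1ᴴ)⁻¹).mulVec (Pi.single (Sum.inl k) 1)) i).arg
            + 2 * Real.pi * n) ↔
      (∃ n : ℤ, φ k i =
          -(star (h k i) *
              ∑ ℓ, R k i ℓ * Complex.exp (-(Complex.I * (φ k ℓ : ℂ))) * h k ℓ).arg
            + 2 * Real.pi * n) := by
  intro k i
  have hgg : ∀ k m, star (g k) ⬝ᵥ g m =
      star ((Φ k)ᴴ.mulVec (h k)) ⬝ᵥ ((H k)ᴴ * H m).mulVec ((Φ m)ᴴ.mulVec (h m)) := by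
    intro k m
    rw [hg k, hg m, star_mulVec, ← dotProduct_mulVec, mulVec_mulVec]
  have hgd : ∀ k u, star (g k) ⬝ᵥ hd u = 0 := by
    intro k u
    rw [hg k, star_mulVec, ← dotProduct_mulVec, hHd, dotProduct_zero]
  have hdg : ∀ k u, star (hd u) ⬝ᵥ g k = 0 := by
    intro k u
    have e := congrArg star (hgd k u)
    rw [star_zero, ← star_dotProduct_star, star_star] at e
    exact e
  have hc : ∀ k, star (g k) ⬝ᵥ g k =
      star (h k) ⬝ᵥ (Φ k * R k * (Φ k)ᴴ).mulVec (h k) := by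
    intro k
    rw [hgg, hR, star_mulVec, conjTranspose_conjTranspose, ← dotProduct_mulVec,
      mulVec_mulVec, mulVec_mulVec, Matrix.mul_assoc]
  have hc0 : ∀ k, star (g k) ⬝ᵥ g k ≠ 0 := by
    intro k h0
    have := hposre k
    rw [← hc, h0] at this
    simp at this
  have hQQ : Q1 * Q1ᴴ = Matrix.diagonal
      (Sum.elim (fun k => star (g k) ⬝ᵥ g k) (fun u => star (hd u) ⬝ᵥ hd u)) := by
    ext a b
    have e : (Q1 * Q1ᴴ) a b = Q1 a ⬝ᵥ star (Q1 b) := rfl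
    have eL : ∀ a, Q1 (Sum.inl a) = star (g a) := fun a => by rw [hQ1]; rfl
    have eR : ∀ a, Q1 (Sum.inr a) = star (hd a) := fun a => by rw [hQ1]; rfl
    rw [e]
    rcases a with a | a <;> rcases b with b | b
    · by_cases hab : a = b
      · subst hab; simp [eL, eR]
      · simp [eL, eR, hab, hgg, horth a b hab]
    · simp [eL, eR, hgd]
    · simp [eL, eR, hdg]
    · by_cases hab : a = b
      · subst hab; simp [eL, eR]
      · simp [eL, eR, hab, hdorth a b hab]
  have hinv : (Q1 * Q1ᴴ)⁻¹ = Matrix.diagonal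
      (Sum.elim (fun k => (star (g k) ⬝ᵥ g k)⁻¹) (fun u => (star (hd u) ⬝ᵥ hd u)⁻¹)) := by
    apply Matrix.inv_eq_right_inv
    rw [hQQ, Matrix.diagonal_mul_diagonal, ← Matrix.diagonal_one]
    congr 1
    ext a
    rcases a with a | a
    · simp only [Sum.elim_inl]; exact mul_inv_cancel₀ (hc0 a)
    · simp only [Sum.elim_inr]; exact mul_inv_cancel₀ (hdu a)
  obtain ⟨r, hr, hrc⟩ : ∃ r : ℝ, 0 < r ∧ star (g k) ⬝ᵥ g k = (r : ℂ) := by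
    refine ⟨_, hposre k, ?_⟩
    rw [hc]
    apply Complex.ext <;> simp [hposim k]
  have hcol : Q1ᴴ.col (Sum.inl k) = g k := by
    ext m
    simp [hQ1, Matrix.col]
  have hvec : (((H k)ᴴ * Q1ᴴ * (Q1 * Q1ᴴ)⁻¹).mulVec (Pi.single (Sum.inl k) 1)) i =
      ((r⁻¹ : ℝ) : ℂ) * ∑ ℓ, R k i ℓ * Complex.exp (-(Complex.I * (φ k ℓ : ℂ))) * h k ℓ := by
    rw [hinv, Matrix.mulVec_single_one, Matrix.col_apply, Matrix.mul_diagonal]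
    simp only [Sum.elim_inl]
    have e1 : ((H k)ᴴ * Q1ᴴ) i (Sum.inl k) = (H k)ᴴ.mulVec (Q1ᴴ.col (Sum.inl k)) i := rfl
    rw [e1, hcol, hg k, mulVec_mulVec, hR, ← hg k, hrc, mul_comm, Complex.ofReal_inv]
    congr 1
    simp only [Matrix.mulVec, dotProduct]
    refine Finset.sum_congr rfl fun l _ => ?_
    rw [mul_assoc]
    congr 1
    have e2 : (∑ x, (Φ k)ᴴ l x * h k x) = ((Φ k)ᴴ.mulVec (h k)) l := rfl
    rw [e2, hΦ k, Matrix.diagonal_conjTranspose, Matrix.mulVec_diagonal]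
    congr 1
    simp [← Complex.exp_conj]
  rw [hvec, mul_left_comm, Complex.arg_real_mul _ (inv_pos.mpr hr)]
end
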